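/- Let μ be a σ-finite measure on a measurable space and let 1 ≤ p < ∞. The following are equivalent: (i) Lᵖ(μ; ℂ) has the ball-covering property; (ii) Lᵖ(μ; ℂ) has the uniform ball-covering property; (iii) Lᵖ(μ; ℂ) is separable. -/

import Mathlib

open MeasureTheory
open scoped ENNReal

noncomputable section

/-- A normed space has the ball-covering property if there is a countable family of open
balls, none of which contains the origin, whose union covers the unit sphere. -/
def HasBCP (X : Type*) [NormedAddCommGroup X] : Prop :=
  ∃ (c : ℕ → X) (r : ℕ → ℝ), (∀ n, r n ≤ ‖c n‖) ∧
    ∀ x : X, ‖x‖ = 1 → ∃ n, ‖x - c n‖ < r n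

/-- A normed space has the uniform ball-covering property: additionally the radii are
uniformly bounded and the balls uniformly omit the origin. -/
def HasUBCP (X : Type*) [NormedAddCommGroup X] : Prop :=
  ∃ (c : ℕ → X) (r : ℕ → ℝ),
    (∃ R : ℝ, ∀ n, r n ≤ R) ∧
    (∃ δ : ℝ, 0 < δ ∧ ∀ n, r n + δ ≤ ‖c n‖) ∧
    ∀ x : X, ‖x‖ = 1 → ∃ n, ‖x - c n‖ < r n

lemma aux_pointwise (c : ℂ) (x q : ℝ) (hq : 1 ≤ q) :
    ‖c‖ ^ q - q * ((‖c‖ ^ (q - 2) * c.re) * x) ≤ ‖(x : ℂ) - c‖ ^ q := by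
  by_cases hc : c = 0
  · subst hc
    simp only [norm_zero, Complex.zero_re, mul_zero, zero_mul, sub_zero]
    rw [Real.zero_rpow (by linarith)]
    positivity
  have hn : 0 < ‖c‖ := norm_pos_iff.mpr hc
  have h1 : ‖c‖ ^ 2 - c.re * x ≤ ‖(x : ℂ) - c‖ * ‖c‖ := by
    have h2 : ((starRingEnd ℂ c) * (c - x)).re ≤ ‖(starRingEnd ℂ c) * (c - x)‖ := Complex.re_le_norm _
    rw [norm_mul, RCLike.norm_conj, norm_sub_rev] at h2
    have h3 : ((starRingEnd ℂ c) * (c - x)).re = ‖c‖ ^ 2 - c.re * x := by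
      rw [← Complex.normSq_eq_norm_sq, Complex.normSq_apply]
      simp
      ring
    rw [h3] at h2
    linarith
  set d := ‖(x : ℂ) - c‖ with hd
  have hd0 : 0 ≤ d := norm_nonneg _
  have hb := one_add_mul_self_le_rpow_one_add (s := d / ‖c‖ - 1)
    (by have : 0 ≤ d / ‖c‖ := by positivity
        linarith) hq
  have e : 1 + (d / ‖c‖ - 1) = d / ‖c‖ := by ring
  rw [e, Real.div_rpow hd0 hn.le, le_div_iff₀ (by positivity)] at hb
  have e2 : ‖c‖ ^ (q - 2) = ‖c‖ ^ q / ‖c‖ ^ 2 := by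
    rw [Real.rpow_sub hn]; norm_num
  rw [e2]
  refine le_trans ?_ hb
  have h4 : -(c.re * x / ‖c‖ ^ 2) ≤ d / ‖c‖ - 1 := by
    have : d / ‖c‖ = d * ‖c‖ / ‖c‖ ^ 2 := by field_simp
    rw [this, le_sub_iff_add_le, ← sub_nonneg]
    have h5 : d * ‖c‖ / ‖c‖ ^ 2 - (-(c.re * x / ‖c‖ ^ 2) + 1)
        = (d * ‖c‖ - (‖c‖ ^ 2 - c.re * x)) / ‖c‖ ^ 2 := by field_simp; ring
    rw [h5]
    apply div_nonneg <;> [linarith; positivity]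
  have hpos : 0 ≤ ‖c‖ ^ q * q := by positivity
  have := mul_le_mul_of_nonneg_left h4 hpos
  have e3 : ‖c‖ ^ q / ‖c‖ ^ 2 * c.re * x = ‖c‖ ^ q * (c.re * x / ‖c‖ ^ 2) := by ring
  rw [e3]
  linarith

lemma aux_bound (c : ℂ) (x q : ℝ) (hq : 1 ≤ q) :
    |(‖c‖ ^ (q - 2) * c.re) * x| ≤ ‖c‖ ^ q + ‖(x : ℂ)‖ ^ q := by
  by_cases hc : c = 0
  · subst hc
    simp only [Complex.zero_re, mul_zero, zero_mul, abs_zero]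
    positivity
  have hn : 0 < ‖c‖ := norm_pos_iff.mpr hc
  have h1 : |(‖c‖ ^ (q - 2) * c.re) * x| ≤ ‖c‖ ^ (q - 1) * |x| := by
    rw [abs_mul, abs_mul, abs_of_nonneg (by positivity : 0 ≤ ‖c‖ ^ (q - 2))]
    gcongr
    calc ‖c‖ ^ (q - 2) * |c.re| ≤ ‖c‖ ^ (q - 2) * ‖c‖ := by
          gcongr; exact Complex.abs_re_le_norm c
      _ = ‖c‖ ^ (q - 1) := by
          rw [← Real.rpow_add_one hn.ne']; congr 1; ring
  refine h1.trans ?_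
  rw [Complex.norm_real, Real.norm_eq_abs]
  have hx := abs_nonneg x
  rcases le_total (|x|) ‖c‖ with h | h
  · calc ‖c‖ ^ (q - 1) * |x| ≤ ‖c‖ ^ (q - 1) * ‖c‖ := by gcongr
      _ = ‖c‖ ^ q := by rw [← Real.rpow_add_one hn.ne']; congr 1; ring
      _ ≤ _ := by
        have : 0 ≤ |x| ^ q := by positivity
        linarith
  · have hx' : 0 < |x| := hn.trans_le h
    calc ‖c‖ ^ (q - 1) * |x| ≤ |x| ^ (q - 1) * |x| := by
          gcongr
      _ = |x| ^ q := by rw [← Real.rpow_add_one hx'.ne']; congr 1; ring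
      _ ≤ _ := by
        have : 0 ≤ ‖c‖ ^ q := by positivity
        linarith

lemma aux_norm {α : Type*} [MeasurableSpace α] {μ : Measure α} {p : ℝ≥0∞} [Fact (1 ≤ p)]
    (hp : p ≠ ⊤) (f : Lp ℂ p μ) : ‖f‖ = (∫ a, ‖f a‖ ^ p.toReal ∂μ) ^ p.toReal⁻¹ := by
  have hp0 : p ≠ 0 := (lt_of_lt_of_le one_pos (Fact.out : 1 ≤ p)).ne'
  rw [Lp.norm_def, MemLp.eLpNorm_eq_integral_rpow_norm hp0 hp (Lp.memLp f),
    ENNReal.toReal_ofReal]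
  positivity

lemma aux_key {α : Type*} {m m0 : MeasurableSpace α} {μ : Measure α} {p : ℝ≥0∞} [Fact (1 ≤ p)]
    (hp : p ≠ ⊤) (hm : m ≤ m0) [SigmaFinite (μ.trim hm)] (c y : Lp ℂ p μ)
    (hc : StronglyMeasurable[m] c) (x : α → ℝ) (hx : Integrable x μ)
    (hy : y =ᵐ[μ] fun a => (x a : ℂ)) (h0 : μ[x | m] =ᵐ[μ] 0) : ‖c‖ ≤ ‖y - c‖ := by
  have hp1 : (1 : ℝ≥0∞) ≤ p := Fact.out
  have hp0 : p ≠ 0 := (lt_of_lt_of_le one_pos hp1).ne'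
  have hq : 1 ≤ p.toReal := by
    have := ENNReal.toReal_mono hp hp1
    simpa using this
  set q := p.toReal with hqd
  set h : α → ℝ := fun a => ‖c a‖ ^ (q - 2) * (c a).re with hh
  have hhm : StronglyMeasurable[m] h := by
    have hcm : Measurable[m] c := hc.measurable
    apply Measurable.stronglyMeasurable
    have hF : Measurable (fun z : ℂ => ‖z‖ ^ (q - 2) * z.re) :=
      (measurable_norm.pow_const _).mul Complex.measurable_re
    exact hF.comp hcm
  have hIc : Integrable (fun a => ‖c a‖ ^ q) μ := (Lp.memLp c).integrable_norm_rpow hp0 hp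
  have hIy : Integrable (fun a => ‖y a‖ ^ q) μ := (Lp.memLp y).integrable_norm_rpow hp0 hp
  have hId : Integrable (fun a => ‖(y - c) a‖ ^ q) μ :=
    (Lp.memLp (y - c)).integrable_norm_rpow hp0 hp
  have hhx : Integrable (h * x) μ := by
    refine (hIc.add hIy).mono' ((hhm.mono hm).aestronglyMeasurable.mul hx.1) ?_
    filter_upwards [hy] with a ha
    have := aux_bound (c a) (x a) q hq
    simpa [ha, hh] using this
  have hz : ∫ a, (h * x) a ∂μ = 0 := by
    rw [← integral_condExp hm]
    have e := condExp_mul_of_stronglyMeasurable_left hhm hhx hx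
    have : μ[h * x | m] =ᵐ[μ] 0 := by
      filter_upwards [e, h0] with a h1 h2
      simp [h1, h2]
    rw [integral_congr_ae this]; simp
  rw [aux_norm hp, aux_norm hp]
  have hle : ∫ a, ‖c a‖ ^ q ∂μ ≤ ∫ a, ‖(y - c) a‖ ^ q ∂μ := by
    have e : ∫ a, (‖c a‖ ^ q - q * (h * x) a) ∂μ = ∫ a, ‖c a‖ ^ q ∂μ := by
      rw [integral_sub hIc (hhx.const_mul q), integral_const_mul, hz]; simp
    rw [← e]
    refine integral_mono_ae (hIc.sub (hhx.const_mul q)) hId ?_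
    filter_upwards [hy, Lp.coeFn_sub y c] with a h1 h2
    have := aux_pointwise (c a) (x a) q hq
    rw [h2, Pi.sub_apply, h1]
    exact this
  have : 0 ≤ ∫ a, ‖c a‖ ^ q ∂μ := integral_nonneg fun a => by positivity
  exact Real.rpow_le_rpow this hle (by positivity)

lemma aux_sigma {α : Type*} [m0 : MeasurableSpace α] (μ : Measure α) [SigmaFinite μ]
    (c : ℕ → α → ℂ) (hc : ∀ n, StronglyMeasurable (c n)) :
    ∃ (m : MeasurableSpace α) (hm : m ≤ m0), @MeasurableSpace.CountablyGenerated α m ∧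
      SigmaFinite (μ.trim hm) ∧ ∀ n, StronglyMeasurable[m] (c n) := by
  let B := TopologicalSpace.countableBasis ℂ
  let S : Set (Set α) := Set.range (spanningSets μ) ∪ ⋃ n, (fun t => c n ⁻¹' t) '' B
  have hS : S.Countable := (Set.countable_range _).union
    (Set.countable_iUnion fun n => (TopologicalSpace.countable_countableBasis ℂ).image _)
  have hm : MeasurableSpace.generateFrom S ≤ m0 := by
    apply MeasurableSpace.generateFrom_le
    rintro t (⟨n, rfl⟩ | ht)
    · exact measurableSet_spanningSets μ n
    · obtain ⟨n, u, hu, rfl⟩ := Set.mem_iUnion.mp ht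
      exact (hc n).measurable (TopologicalSpace.isOpen_of_mem_countableBasis hu).measurableSet
  refine ⟨MeasurableSpace.generateFrom S, hm, ?_, ?_, ?_⟩
  · exact @MeasurableSpace.CountablyGenerated.mk α (MeasurableSpace.generateFrom S) ⟨S, hS, rfl⟩
  · refine ⟨⟨⟨spanningSets μ, fun _ => trivial, fun n => ?_, iUnion_spanningSets μ⟩⟩⟩
    rw [trim_measurableSet_eq hm]
    · exact measure_spanningSets_lt_top μ n
    · exact MeasurableSpace.measurableSet_generateFrom (Or.inl ⟨n, rfl⟩)
  · intro n
    have : Measurable[MeasurableSpace.generateFrom S] (c n) := by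
      have e : (inferInstance : MeasurableSpace ℂ) = MeasurableSpace.generateFrom B :=
        (BorelSpace.measurable_eq (α := ℂ)).trans
          (TopologicalSpace.isBasis_countableBasis ℂ).borel_eq_generateFrom
      suffices h : @Measurable _ _ (MeasurableSpace.generateFrom S)
          (MeasurableSpace.generateFrom B) (c n) by
        rw [← e] at h
        exact h
      apply @measurable_generateFrom _ _ (MeasurableSpace.generateFrom S)
      intro t ht
      exact MeasurableSpace.measurableSet_generateFrom
        (Or.inr (Set.mem_iUnion.mpr ⟨n, t, ht, rfl⟩))
    exact this.stronglyMeasurable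

lemma aux_isSeparable {α : Type*} {m m0 : MeasurableSpace α} (μ : Measure α)
    (hm : m ≤ m0) (hg : @MeasurableSpace.CountablyGenerated α m)
    [SigmaFinite (μ.trim hm)]
    (H : ∀ s, MeasurableSet s → μ s ≠ ⊤ → ∃ t, MeasurableSet[m] t ∧ s =ᵐ[μ] t) :
    MeasureTheory.IsSeparable μ := by
  obtain ⟨A, hA, hd⟩ := @exists_countable_measureDense α m (μ.trim hm) inferInstance
  have hd1 := @Measure.MeasureDense.measurable α m _ _ hd
  have hd2 := @Measure.MeasureDense.approx α m _ _ hd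
  refine ⟨A, hA, fun s h => hm _ (hd1 s h), fun s hs hfin ε hε => ?_⟩
  obtain ⟨t, ht, hst⟩ := H s hs hfin
  obtain ⟨u, hu, hlt⟩ := hd2 t ht
    (by rw [trim_measurableSet_eq hm ht, ← measure_congr hst]; exact hfin) ε hε
  refine ⟨u, hu, ?_⟩
  have hum := hd1 u hu
  rw [trim_measurableSet_eq hm (ht.symmDiff hum)] at hlt
  rwa [measure_congr (hst.symmDiff (Filter.EventuallyEq.refl _ u))]

lemma aux_main {α : Type*} {m m0 : MeasurableSpace α}
    (μ : Measure α) (p : ℝ≥0∞) [Fact (1 ≤ p)] (hp : p ≠ ⊤)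
    (hm : m ≤ m0) [SigmaFinite (μ.trim hm)] (c : ℕ → Lp ℂ p μ) (r : ℕ → ℝ)
    (hr : ∀ n, r n ≤ ‖c n‖) (hcov : ∀ x : Lp ℂ p μ, ‖x‖ = 1 → ∃ n, ‖x - c n‖ < r n)
    (hcm : ∀ n, StronglyMeasurable[m] (c n)) (s : Set α) (hs : MeasurableSet s)
    (hfin : μ s ≠ ⊤) : ∃ t, MeasurableSet[m] t ∧ s =ᵐ[μ] t := by
  have hp1 : (1 : ℝ≥0∞) ≤ p := Fact.out
  have hp0 : p ≠ 0 := (lt_of_lt_of_le one_pos hp1).ne'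
  have hq : 1 ≤ p.toReal := by
    have := ENNReal.toReal_mono hp hp1
    simpa using this
  set f : α → ℝ := s.indicator (fun _ => 1) with hf
  have hfi : Integrable f μ := (integrable_indicator_iff hs).mpr (integrableOn_const hfin)
  set g : α → ℝ := μ[f | m] with hgd
  have hgi : Integrable g μ := integrable_condExp
  have hgm : StronglyMeasurable[m] g := stronglyMeasurable_condExp
  set x : α → ℝ := f - g with hxd
  have hxi : Integrable x μ := hfi.sub hgi
  have hx0 : μ[x | m] =ᵐ[μ] 0 := by
    filter_upwards [condExp_sub hfi hgi m] with a ha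
    rw [ha, condExp_of_stronglyMeasurable hm hgm hgi]
    simp [hgd]
  have hgb : ∀ᵐ a ∂μ, |g a| ≤ 1 := by
    refine ae_bdd_abs_condExp_of_ae_bdd_abs (R := 1) (Filter.Eventually.of_forall fun a => ?_)
    by_cases h : a ∈ s <;> simp [hf, h]
  have hg0 : 0 ≤ᵐ[μ] g := condExp_nonneg (Filter.Eventually.of_forall fun a => by
    by_cases h : a ∈ s <;> simp [hf, h])
  have hxb : ∀ᵐ a ∂μ, ‖x a‖ ≤ 1 := by
    filter_upwards [hgb, hg0] with a h1 h2
    have h1' := (abs_le.mp h1).2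
    simp only [Pi.zero_apply] at h2
    rw [Real.norm_eq_abs, abs_le]
    by_cases h : a ∈ s <;> simp [hxd, hf, h] <;> constructor <;> linarith
  have hxp : MemLp x p μ := by
    rw [← integrable_norm_rpow_iff hxi.1 hp0 hp]
    refine hxi.norm.mono' (hxi.1.norm.aemeasurable.pow_const _).aestronglyMeasurable ?_
    filter_upwards [hxb] with a ha
    rw [Real.norm_eq_abs, abs_of_nonneg (by positivity)]
    exact Real.rpow_le_self_of_le_one (norm_nonneg _) ha hq
  have hxp' : MemLp (fun a => (x a : ℂ)) p μ := hxp.ofReal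
  set X : Lp ℂ p μ := hxp'.toLp _ with hX
  have hX0 : X = 0 := by
    by_contra hne
    have hn : 0 < ‖X‖ := norm_pos_iff.mpr hne
    obtain ⟨n, hlt⟩ := hcov (((‖X‖⁻¹ : ℝ) : ℂ) • X) (by
      rw [norm_smul, Complex.norm_real, norm_inv, norm_norm, inv_mul_cancel₀ hn.ne'])
    have := aux_key hp hm (c n) (((‖X‖⁻¹ : ℝ) : ℂ) • X) (hcm n) (‖X‖⁻¹ • x) (hxi.smul _) (by
        filter_upwards [Lp.coeFn_smul (((‖X‖⁻¹ : ℝ) : ℂ)) X, hxp'.coeFn_toLp] with a h1 h2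
        rw [h1, Pi.smul_apply, h2]
        simp) (by
        filter_upwards [condExp_smul (‖X‖⁻¹) x m, hx0] with a h1 h2
        rw [h1, Pi.smul_apply, h2]; simp)
    linarith [hr n]
  have hx00 : ∀ᵐ a ∂μ, x a = 0 := by
    have h1 := hxp'.coeFn_toLp
    rw [← hX, hX0] at h1
    filter_upwards [h1, Lp.coeFn_zero ℂ p μ] with a h2 h3
    rw [h3] at h2
    simpa using h2.symm
  refine ⟨g ⁻¹' {1}, hgm.measurable (measurableSet_singleton 1), ?_⟩
  rw [Filter.eventuallyEq_set]
  filter_upwards [hx00] with a ha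
  have : g a = f a := by simp [hxd] at ha; linarith
  by_cases h : a ∈ s <;> simp [this, hf, h]

lemma aux_bcp_sep {α : Type*} [m0 : MeasurableSpace α]
    (μ : Measure α) [SigmaFinite μ] (p : ℝ≥0∞) [Fact (1 ≤ p)] (hp : p ≠ ⊤)
    (hB : HasBCP (Lp ℂ p μ)) : TopologicalSpace.SeparableSpace (Lp ℂ p μ) := by
  suffices MeasureTheory.IsSeparable μ by
    have : Fact (p ≠ ⊤) := ⟨hp⟩
    infer_instance
  obtain ⟨c, r, hr, hcov⟩ := hB
  obtain ⟨m, hm, hg, hsf, hcm⟩ := aux_sigma μ (fun n => c n) (fun n => Lp.stronglyMeasurable (c n))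
  exact aux_isSeparable μ hm hg (aux_main μ p hp hm c r hr hcov hcm)

lemma aux_sep_ubcp {X : Type*} [NormedAddCommGroup X] (h : TopologicalSpace.SeparableSpace X) :
    HasUBCP X := by
  classical
  refine ⟨TopologicalSpace.denseSeq X,
    fun n => if 3 / 4 ≤ ‖TopologicalSpace.denseSeq X n‖ then 1 / 2 else -1, ⟨1, fun n => ?_⟩,
    ⟨1 / 4, by norm_num, fun n => ?_⟩, fun x hx => ?_⟩
  · dsimp only; split_ifs <;> norm_num
  · have := norm_nonneg (TopologicalSpace.denseSeq X n)
    dsimp only; split_ifs <;> linarith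
  · obtain ⟨n, hn⟩ := (TopologicalSpace.denseRange_denseSeq X).exists_dist_lt x
      (show (0 : ℝ) < 1 / 4 by norm_num)
    rw [dist_eq_norm] at hn
    refine ⟨n, ?_⟩
    have h2 := norm_sub_norm_le x (TopologicalSpace.denseSeq X n)
    have h3 : 3 / 4 ≤ ‖TopologicalSpace.denseSeq X n‖ := by linarith
    simp only [if_pos h3]
    linarith

lemma aux_ubcp_bcp {X : Type*} [NormedAddCommGroup X] (h : HasUBCP X) : HasBCP X := by
  obtain ⟨c, r, -, ⟨δ, hδ, h⟩, h'⟩ := h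
  exact ⟨c, r, fun n => by linarith [h n], h'⟩

/-- Let `μ` be a σ-finite measure and `1 ≤ p < ∞`.  The following are
equivalent: (i) `Lᵖ(μ; ℂ)` has the BCP; (ii) `Lᵖ(μ; ℂ)` has the UBCP;
(iii) `Lᵖ(μ; ℂ)` is separable. -/
theorem Lp_BCP_iff_UBCP_iff_separable {α : Type*} [MeasurableSpace α]
    (μ : Measure α) [SigmaFinite μ] (p : ℝ≥0∞) [Fact (1 ≤ p)] (hp : p ≠ ⊤) :
    (HasBCP (Lp ℂ p μ) ↔ TopologicalSpace.SeparableSpace (Lp ℂ p μ)) ∧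
    (HasUBCP (Lp ℂ p μ) ↔ TopologicalSpace.SeparableSpace (Lp ℂ p μ)) := by
  have h1 := aux_bcp_sep μ p hp
  exact ⟨⟨h1, fun h => aux_ubcp_bcp (aux_sep_ubcp h)⟩,
    ⟨fun h => h1 (aux_ubcp_bcp h), aux_sep_ubcp⟩⟩
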